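/- Fix s≥0. Let ζ^k (k∈ℕ) and ζ be complex sequences in h^{1/2+s}_+ such that ‖ζ^k − ζ‖_{h^{1/2+s}} → 0 as k→∞. Then for every T>0, sup_{|t|≤T} ‖(ζ^k_n·e^{i ω_n^{(4)}(ζ^k) t})_{n≥1} − (ζ_n·e^{i ω_n^{(4)}(ζ) t})_{n≥1}‖_{h^{1/2+s}} → 0 as k→∞. -/

import Mathlib

/-- The frequencies `ω_n^{(4)}` of the third-order Benjamin–Ono equation, in terms of
the actions `γ_p` (indexed by `p ≥ 1`; terms with index `0` carry a zero factor, so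
summing over `ℕ` is the same as summing over indices `≥ 1`):
`ω_n^{(4)}(γ) = n³ + n ∑_{p≥1} p γ_p − 3 ∑_{p≥1} min(p,n)² γ_p
  + 3 ∑_{p,q≥1} min(p,q,n) γ_p γ_q`. -/
noncomputable def omega4 (γ : ℕ → ℝ) (n : ℕ) : ℝ :=
  (n : ℝ) ^ 3 + (n : ℝ) * (∑' p : ℕ, (p : ℝ) * γ p)
    - 3 * (∑' p : ℕ, ((min p n : ℕ) : ℝ) ^ 2 * γ p)
    + 3 * (∑' pq : ℕ × ℕ, ((min (min pq.1 pq.2) n : ℕ) : ℝ) * γ pq.1 * γ pq.2)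

open Filter Topology in
lemma tendsto_tsum_of_abs_sub_le {ι : Type*} {f v : ℕ → ι → ℝ} {g : ι → ℝ}
    (hf : ∀ k, Summable (f k)) (hg : Summable g) (hv : ∀ k, Summable (v k))
    (h : ∀ k i, |f k i - g i| ≤ v k i) (hv0 : Tendsto (fun k => ∑' i, v k i) atTop (𝓝 0)) :
    Tendsto (fun k => ∑' i, f k i) atTop (𝓝 (∑' i, g i)) := by
  rw [tendsto_iff_norm_sub_tendsto_zero]
  refine squeeze_zero (fun _ => norm_nonneg _) (fun k => ?_) hv0
  rw [← (hf k).tsum_sub hg]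
  exact tsum_of_norm_bounded (hv k).hasSum (h k)

open Filter Topology in
/-- Each frequency is continuous with respect to the weighted `ℓ¹` distance of the actions. -/
lemma tendsto_omega4 {γk : ℕ → ℕ → ℝ} {γ : ℕ → ℝ} (hk0 : ∀ k p, 0 ≤ γk k p) (h0 : ∀ p, 0 ≤ γ p)
    (hk : ∀ k, Summable fun p : ℕ => (p : ℝ) * γk k p) (h : Summable fun p : ℕ => (p : ℝ) * γ p)
    (hlim : Tendsto (fun k => ∑' p : ℕ, (p : ℝ) * |γk k p - γ p|) atTop (𝓝 0)) (n : ℕ) :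
    Tendsto (fun k => omega4 (γk k) n) atTop (𝓝 (omega4 γ n)) := by
  have hd (k) : Summable fun p : ℕ => (p : ℝ) * |γk k p - γ p| := by
    refine ((hk k).sub h).abs.congr fun p => ?_
    rw [← mul_sub, abs_mul, Nat.abs_cast]
  have hS : Tendsto (fun k => ∑' p : ℕ, (p : ℝ) * γk k p) atTop
      (𝓝 (∑' p : ℕ, (p : ℝ) * γ p)) := by
    refine tendsto_tsum_of_abs_sub_le hk h hd (fun k p => ?_) hlim
    rw [← mul_sub, abs_mul, Nat.abs_cast]
  have hmin (p : ℕ) : ((min p n : ℕ) : ℝ) ^ 2 ≤ n * p := by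
    rw [sq, mul_comm (n : ℝ)]
    gcongr
    · exact min_le_left _ _
    · exact min_le_right _ _
  have hQsum {u : ℕ → ℝ} (hu0 : ∀ p, 0 ≤ u p) (hu : Summable fun p : ℕ => (p : ℝ) * u p) :
      Summable fun p : ℕ => ((min p n : ℕ) : ℝ) ^ 2 * u p := by
    refine (hu.mul_left (n : ℝ)).of_nonneg_of_le (fun p => mul_nonneg (by positivity) (hu0 p))
      fun p => ?_
    rw [← mul_assoc]
    exact mul_le_mul_of_nonneg_right (hmin p) (hu0 p)
  have hQ : Tendsto (fun k => ∑' p : ℕ, ((min p n : ℕ) : ℝ) ^ 2 * γk k p) atTop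
      (𝓝 (∑' p : ℕ, ((min p n : ℕ) : ℝ) ^ 2 * γ p)) := by
    refine tendsto_tsum_of_abs_sub_le (fun k => hQsum (hk0 k) (hk k)) (hQsum h0 h)
      (fun k => (hd k).mul_left (n : ℝ)) (fun k p => ?_) ?_
    · rw [← mul_sub, abs_mul, abs_of_nonneg (by positivity), ← mul_assoc]
      exact mul_le_mul_of_nonneg_right (hmin p) (abs_nonneg _)
    · simpa [tsum_mul_left] using hlim.const_mul (n : ℝ)
  have hmin3 (p q : ℕ) : ((min (min p q) n : ℕ) : ℝ) ≤ p * q := by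
    rw [← Nat.cast_mul]
    refine Nat.cast_le.2 ((min_le_left _ _).trans ?_)
    rcases Nat.eq_zero_or_pos q with rfl | hq
    · simp
    · exact (min_le_left _ _).trans (Nat.le_mul_of_pos_right p hq)
  have hprod {u v : ℕ → ℝ} (hu0 : ∀ p, 0 ≤ u p) (hv0 : ∀ p, 0 ≤ v p)
      (hu : Summable fun p : ℕ => (p : ℝ) * u p) (hv : Summable fun p : ℕ => (p : ℝ) * v p) :
      Summable fun pq : ℕ × ℕ => ((pq.1 : ℝ) * u pq.1) * ((pq.2 : ℝ) * v pq.2) :=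
    hu.mul_of_nonneg hv (fun p => mul_nonneg (Nat.cast_nonneg p) (hu0 p))
      (fun p => mul_nonneg (Nat.cast_nonneg p) (hv0 p))
  have hRsum {u : ℕ → ℝ} (hu0 : ∀ p, 0 ≤ u p) (hu : Summable fun p : ℕ => (p : ℝ) * u p) :
      Summable fun pq : ℕ × ℕ => ((min (min pq.1 pq.2) n : ℕ) : ℝ) * u pq.1 * u pq.2 := by
    refine (hprod hu0 hu0 hu hu).of_nonneg_of_le
      (fun pq => mul_nonneg (mul_nonneg (Nat.cast_nonneg _) (hu0 _)) (hu0 _)) fun pq => ?_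
    have := mul_le_mul_of_nonneg_right (hmin3 pq.1 pq.2) (mul_nonneg (hu0 pq.1) (hu0 pq.2))
    linarith
  have hR : Tendsto
      (fun k => ∑' pq : ℕ × ℕ, ((min (min pq.1 pq.2) n : ℕ) : ℝ) * γk k pq.1 * γk k pq.2) atTop
      (𝓝 (∑' pq : ℕ × ℕ, ((min (min pq.1 pq.2) n : ℕ) : ℝ) * γ pq.1 * γ pq.2)) := by
    have h1 (k) := hprod (fun p => abs_nonneg (γk k p - γ p)) (hk0 k) (hd k) (hk k)
    have h2 (k) := hprod h0 (fun p => abs_nonneg (γk k p - γ p)) h (hd k)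
    refine tendsto_tsum_of_abs_sub_le (fun k => hRsum (hk0 k) (hk k)) (hRsum h0 h)
      (fun k => (h1 k).add (h2 k)) (fun k pq => ?_) ?_
    · obtain ⟨p, q⟩ := pq
      dsimp only
      have hb : |γk k p * γk k q - γ p * γ q| ≤
          |γk k p - γ p| * γk k q + γ p * |γk k q - γ q| := by
        rw [show γk k p * γk k q - γ p * γ q =
          (γk k p - γ p) * γk k q + γ p * (γk k q - γ q) by ring]
        refine (abs_add_le _ _).trans_eq ?_
        rw [abs_mul, abs_mul, abs_of_nonneg (hk0 k q), abs_of_nonneg (h0 p)]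
      calc _ = ((min (min p q) n : ℕ) : ℝ) * |γk k p * γk k q - γ p * γ q| := by
            rw [mul_assoc, mul_assoc, ← mul_sub, abs_mul, Nat.abs_cast]
        _ ≤ (p * q) * (|γk k p - γ p| * γk k q + γ p * |γk k q - γ q|) :=
            mul_le_mul (hmin3 p q) hb (abs_nonneg _) (by positivity)
        _ = _ := by ring
    · have e (k) := ((h1 k).tsum_add (h2 k)).trans (congrArg₂ (· + ·)
        ((hd k).tsum_mul_tsum (hk k) (h1 k)).symm (h.tsum_mul_tsum (hd k) (h2 k)).symm)
      simp only [e]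
      simpa using (hlim.mul hS).add (hlim.const_mul (∑' p : ℕ, (p : ℝ) * γ p))
  unfold omega4
  exact (((hS.const_mul _).const_add _).sub (hQ.const_mul _)).add (hR.const_mul _)

open Filter Topology in
/-- Convergence in a weighted `ℓ²` space implies convergence of the squared moduli in the
corresponding weighted `ℓ¹` space. -/
lemma tendsto_tsum_mul_abs_normSq_sub {w : ℕ → ℝ} (hw : ∀ n, 0 ≤ w n)
    {a : ℕ → ℕ → ℂ} {b : ℕ → ℂ} (hb : Summable fun n => w n * ‖b n‖ ^ 2)
    (hab : ∀ k, Summable fun n => w n * ‖a k n - b n‖ ^ 2)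
    (hlim : Tendsto (fun k => ∑' n, w n * ‖a k n - b n‖ ^ 2) atTop (𝓝 0)) :
    Tendsto (fun k => ∑' n, w n * |‖a k n‖ ^ 2 - ‖b n‖ ^ 2|) atTop (𝓝 0) := by
  have hsq (c : ℂ) (n : ℕ) : (√(w n) * ‖c‖) ^ (2 : ℝ) = w n * ‖c‖ ^ 2 := by
    rw [Real.rpow_two, mul_pow, Real.sq_sqrt (hw n)]
  have hCS (k) := Real.summable_and_inner_le_Lp_mul_Lq_tsum_of_nonneg
    Real.HolderConjugate.two_two
    (f := fun n => √(w n) * ‖a k n - b n‖) (g := fun n => √(w n) * ‖b n‖)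
    (fun n => by positivity) (fun n => by positivity)
    (by simpa only [hsq] using hab k) (by simpa only [hsq] using hb)
  simp only [hsq, ← Real.sqrt_eq_rpow] at hCS
  have hpt (k n) : w n * |‖a k n‖ ^ 2 - ‖b n‖ ^ 2| ≤
      w n * ‖a k n - b n‖ ^ 2 + 2 * (√(w n) * ‖a k n - b n‖ * (√(w n) * ‖b n‖)) := by
    have h1 : |‖a k n‖ - ‖b n‖| ≤ ‖a k n - b n‖ := abs_norm_sub_norm_le _ _
    have h2 : ‖a k n‖ + ‖b n‖ ≤ ‖a k n - b n‖ + 2 * ‖b n‖ := by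
      linarith [norm_sub_norm_le (a k n) (b n)]
    have h3 : |‖a k n‖ ^ 2 - ‖b n‖ ^ 2| ≤ ‖a k n - b n‖ * (‖a k n - b n‖ + 2 * ‖b n‖) := by
      rw [sq_sub_sq, abs_mul, abs_of_nonneg (by positivity : 0 ≤ ‖a k n‖ + ‖b n‖), mul_comm]
      exact mul_le_mul h1 h2 (by positivity) (norm_nonneg _)
    refine (mul_le_mul_of_nonneg_left h3 (hw n)).trans_eq ?_
    linear_combination (-2 * ‖a k n - b n‖ * ‖b n‖) * Real.mul_self_sqrt (hw n)
  have hmaj (k) := (hab k).add ((hCS k).1.mul_left 2)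
  refine squeeze_zero (fun k => tsum_nonneg fun n => mul_nonneg (hw n) (abs_nonneg _))
    (fun k => ?_) (g := fun k => ∑' n, w n * ‖a k n - b n‖ ^ 2 +
      2 * (√(∑' n, w n * ‖a k n - b n‖ ^ 2) * √(∑' n, w n * ‖b n‖ ^ 2))) ?_
  · refine (((hmaj k).of_nonneg_of_le (fun n => mul_nonneg (hw n) (abs_nonneg _))
      (hpt k)).tsum_le_tsum (hpt k) (hmaj k)).trans ?_
    rw [(hab k).tsum_add ((hCS k).1.mul_left 2), tsum_mul_left]
    gcongr
    exact (hCS k).2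
  · have hs := (Real.continuous_sqrt.tendsto 0).comp hlim
    simpa using hlim.add ((hs.mul_const (√(∑' n, w n * ‖b n‖ ^ 2))).const_mul 2)

lemma norm_exp_I_mul_sub_exp_I_mul_le (A B t : ℝ) :
    ‖Complex.exp (Complex.I * A * t) - Complex.exp (Complex.I * B * t)‖ ≤ min 2 (|t| * |A - B|) := by
  have hn (x : ℝ) : ‖Complex.exp (Complex.I * x * t)‖ = 1 := by
    rw [mul_assoc, ← Complex.ofReal_mul, mul_comm, Complex.norm_exp_ofReal_mul_I]
  refine le_min ?_ ?_
  · refine (norm_sub_le _ _).trans ?_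
    rw [hn, hn]
    norm_num
  · have : Complex.exp (Complex.I * A * t) - Complex.exp (Complex.I * B * t) =
        Complex.exp (Complex.I * B * t) *
          (Complex.exp (Complex.I * ((t * (A - B) : ℝ) : ℂ)) - 1) := by
      rw [mul_sub, ← Complex.exp_add, mul_one]
      congr 2
      push_cast
      ring
    rw [this, norm_mul, hn, one_mul, ← abs_mul]
    exact Real.norm_exp_I_mul_ofReal_sub_one_le

lemma sq_norm_mul_sub_mul_le (a b e f : ℂ) (he : ‖e‖ = 1) :
    ‖a * e - b * f‖ ^ 2 ≤ 2 * ‖a - b‖ ^ 2 + 2 * (‖b‖ ^ 2 * ‖e - f‖ ^ 2) := by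
  have h : ‖a * e - b * f‖ ≤ ‖a - b‖ + ‖b‖ * ‖e - f‖ := by
    rw [show a * e - b * f = (a - b) * e + b * (e - f) by ring]
    refine (norm_add_le _ _).trans_eq ?_
    rw [norm_mul, norm_mul, he, mul_one]
  have := pow_le_pow_left₀ (norm_nonneg _) h 2
  nlinarith [sq_nonneg (‖a - b‖ - ‖b‖ * ‖e - f‖)]

/-- if `ζ^k → ζ` in `h^{1/2+s}_+` (`s ≥ 0`), then the Birkhoff flows
`(ζ^k_n e^{i ω_n^{(4)}(ζ^k) t})_n` converge to `(ζ_n e^{i ω_n^{(4)}(ζ) t})_n` in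
`h^{1/2+s}_+`, uniformly on bounded time intervals. -/
theorem flow_tendsto_uniformly_of_h_tendsto (s : ℝ) (hs : 0 ≤ s)
    (ζk : ℕ → ℕ → ℂ) (ζ : ℕ → ℂ)
    (hζ : Summable fun n : ℕ => (n : ℝ) ^ (1 + 2 * s) * ‖ζ n‖ ^ 2)
    (hζk : ∀ k, Summable fun n : ℕ => (n : ℝ) ^ (1 + 2 * s) * ‖ζk k n‖ ^ 2)
    (hconv : Filter.Tendsto
      (fun k => ∑' n : ℕ, (n : ℝ) ^ (1 + 2 * s) * ‖ζk k n - ζ n‖ ^ 2)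
      Filter.atTop (nhds 0)) :
    ∀ T > (0 : ℝ), ∀ ε > (0 : ℝ), ∃ K : ℕ, ∀ k ≥ K, ∀ t : ℝ, |t| ≤ T →
      Real.sqrt (∑' n : ℕ, (n : ℝ) ^ (1 + 2 * s) *
        ‖ζk k n * Complex.exp (Complex.I * (omega4 (fun m => ‖ζk k m‖ ^ 2) n : ℝ) * (t : ℂ))
          - ζ n * Complex.exp (Complex.I * (omega4 (fun m => ‖ζ m‖ ^ 2) n : ℝ) * (t : ℂ))‖ ^ 2)
        < ε := by
  intro T hT ε hε
  set w : ℕ → ℝ := fun n => (n : ℝ) ^ (1 + 2 * s) with hwdef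
  have hw (n) : 0 ≤ w n := Real.rpow_nonneg (Nat.cast_nonneg n) _
  have hle (n : ℕ) : (n : ℝ) ≤ w n := by
    rcases Nat.eq_zero_or_pos n with rfl | hn
    · simpa using hw 0
    · exact Real.self_le_rpow_of_one_le (by exact_mod_cast hn) (by linarith)
  have hdiff (k) : Summable fun n => w n * ‖ζk k n - ζ n‖ ^ 2 := by
    refine (((hζk k).mul_left 2).add (hζ.mul_left 2)).of_nonneg_of_le
      (fun n => mul_nonneg (hw n) (sq_nonneg _)) fun n => ?_
    have h1 := pow_le_pow_left₀ (norm_nonneg _) (norm_sub_le (ζk k n) (ζ n)) 2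
    have h2 : ‖ζk k n - ζ n‖ ^ 2 ≤ 2 * ‖ζk k n‖ ^ 2 + 2 * ‖ζ n‖ ^ 2 := by
      nlinarith [sq_nonneg (‖ζk k n‖ - ‖ζ n‖)]
    refine (mul_le_mul_of_nonneg_left h2 (hw n)).trans_eq ?_
    simp only [hwdef]
    ring
  have hlow {u : ℕ → ℝ} (hu0 : ∀ n, 0 ≤ u n) (hu : Summable fun n => w n * u n) :
      Summable fun n : ℕ => (n : ℝ) * u n :=
    hu.of_nonneg_of_le (fun n => mul_nonneg (Nat.cast_nonneg n) (hu0 n))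
      fun n => mul_le_mul_of_nonneg_right (hle n) (hu0 n)
  have hlim1 : Filter.Tendsto (fun k => ∑' n : ℕ, (n : ℝ) * ‖ζk k n - ζ n‖ ^ 2)
      Filter.atTop (nhds 0) := by
    refine squeeze_zero (fun k => tsum_nonneg fun n => by positivity) (fun k => ?_) hconv
    exact (hlow (fun n => sq_nonneg _) (hdiff k)).tsum_le_tsum
      (fun n => mul_le_mul_of_nonneg_right (hle n) (sq_nonneg _)) (hdiff k)
  have hω (n) : Filter.Tendsto (fun k => omega4 (fun m => ‖ζk k m‖ ^ 2) n) Filter.atTop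
      (nhds (omega4 (fun m => ‖ζ m‖ ^ 2) n)) :=
    tendsto_omega4 (fun _ _ => sq_nonneg _) (fun _ => sq_nonneg _)
      (fun k => hlow (fun _ => sq_nonneg _) (hζk k)) (hlow (fun _ => sq_nonneg _) hζ)
      (tendsto_tsum_mul_abs_normSq_sub (fun n => Nat.cast_nonneg n)
        (hlow (fun _ => sq_nonneg _) hζ) (fun k => hlow (fun _ => sq_nonneg _) (hdiff k)) hlim1) n
  set δ : ℕ → ℕ → ℝ := fun k n =>
    min 2 (T * |omega4 (fun m => ‖ζk k m‖ ^ 2) n - omega4 (fun m => ‖ζ m‖ ^ 2) n|) with hδdef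
  have hδ0 (k n) : 0 ≤ δ k n := le_min zero_le_two (mul_nonneg hT.le (abs_nonneg _))
  have hδlim (n) : Filter.Tendsto (fun k => δ k n) Filter.atTop (nhds 0) := by
    have h := ((hω n).sub_const (omega4 (fun m => ‖ζ m‖ ^ 2) n)).abs.const_mul T
    simpa using (tendsto_const_nhds (x := (2 : ℝ))).min h
  have hδle (k n) : w n * (‖ζ n‖ ^ 2 * δ k n ^ 2) ≤ 4 * (w n * ‖ζ n‖ ^ 2) := by
    have h4 : δ k n ^ 2 ≤ 4 := by
      have := pow_le_pow_left₀ (hδ0 k n) (min_le_left _ _) 2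
      linarith
    have := mul_le_mul_of_nonneg_left h4 (mul_nonneg (hw n) (sq_nonneg ‖ζ n‖))
    linarith
  have hδ_nonneg (k n) : 0 ≤ w n * (‖ζ n‖ ^ 2 * δ k n ^ 2) :=
    mul_nonneg (hw n) (by positivity)
  have hphase_sum (k) : Summable fun n => w n * (‖ζ n‖ ^ 2 * δ k n ^ 2) :=
    (hζ.mul_left 4).of_nonneg_of_le (hδ_nonneg k) (hδle k)
  have hphase : Filter.Tendsto (fun k => ∑' n, w n * (‖ζ n‖ ^ 2 * δ k n ^ 2)) Filter.atTop
      (nhds 0) := by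
    have h := tendsto_tsum_of_dominated_convergence (𝓕 := Filter.atTop)
      (f := fun k n => w n * (‖ζ n‖ ^ 2 * δ k n ^ 2)) (g := fun _ => (0 : ℝ))
      (bound := fun n => 4 * (w n * ‖ζ n‖ ^ 2)) (hζ.mul_left 4)
      (fun n => by simpa using (((hδlim n).pow 2).const_mul (‖ζ n‖ ^ 2)).const_mul (w n))
      (Filter.Eventually.of_forall fun k n => by
        rw [Real.norm_of_nonneg (hδ_nonneg k n)]
        exact hδle k n)
    simpa using h
  have htot := (hconv.const_mul 2).add (hphase.const_mul 2)
  simp only [mul_zero, add_zero] at htot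
  obtain ⟨K, hK⟩ := Filter.eventually_atTop.1 (htot.eventually_lt_const (pow_pos hε 2))
  refine ⟨K, fun k hk t ht => ?_⟩
  rw [Real.sqrt_lt' hε]
  refine lt_of_le_of_lt ?_ (hK k hk)
  have hpt (n : ℕ) : w n *
      ‖ζk k n * Complex.exp (Complex.I * (omega4 (fun m => ‖ζk k m‖ ^ 2) n : ℝ) * (t : ℂ))
        - ζ n * Complex.exp (Complex.I * (omega4 (fun m => ‖ζ m‖ ^ 2) n : ℝ) * (t : ℂ))‖ ^ 2 ≤
      2 * (w n * ‖ζk k n - ζ n‖ ^ 2) + 2 * (w n * (‖ζ n‖ ^ 2 * δ k n ^ 2)) := by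
    have hexp := (norm_exp_I_mul_sub_exp_I_mul_le (omega4 (fun m => ‖ζk k m‖ ^ 2) n)
      (omega4 (fun m => ‖ζ m‖ ^ 2) n) t).trans
      (min_le_min_left 2 (mul_le_mul_of_nonneg_right ht (abs_nonneg _)))
    have h1 := sq_norm_mul_sub_mul_le (ζk k n) (ζ n)
      (Complex.exp (Complex.I * (omega4 (fun m => ‖ζk k m‖ ^ 2) n : ℝ) * (t : ℂ)))
      (Complex.exp (Complex.I * (omega4 (fun m => ‖ζ m‖ ^ 2) n : ℝ) * (t : ℂ)))
      (by rw [mul_assoc, ← Complex.ofReal_mul, mul_comm, Complex.norm_exp_ofReal_mul_I])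
    have h2 := mul_le_mul_of_nonneg_left (pow_le_pow_left₀ (norm_nonneg _) hexp 2)
      (sq_nonneg ‖ζ n‖)
    refine (mul_le_mul_of_nonneg_left (h1.trans (add_le_add_right
      (mul_le_mul_of_nonneg_left h2 zero_le_two) _)) (hw n)).trans_eq ?_
    simp only [hδdef]
    ring
  have hmaj := ((hdiff k).mul_left 2).add ((hphase_sum k).mul_left 2)
  refine ((hmaj.of_nonneg_of_le (fun n => mul_nonneg (hw n) (sq_nonneg _)) hpt).tsum_le_tsum
    hpt hmaj).trans_eq ?_
  rw [((hdiff k).mul_left 2).tsum_add ((hphase_sum k).mul_left 2), tsum_mul_left, tsum_mul_left]
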